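/- The Z-error on qubit 6 is flagged by the syndrome (1,1,1) and only by it: for every ψ in the codespace C, gX j (Z 6 ψ) = −(Z 6 ψ) for all three j ∈ Fin 3, whereas for every i ∈ Fin 7 with i ≠ 6 there exists j ∈ Fin 3 with gX j (Z i ψ) = Z i ψ. (This is the paper's derivation of the correction condition z₆ = d ∧ e ∧ f.) -/

import Mathlib

noncomputable section

abbrev V7 := Fin 7 → ZMod 2
abbrev H7 := V7 → ℂ

/-- The three Steane-code supports. -/
def S : Fin 3 → Finset (Fin 7)
  | 0 => {0, 4, 5, 6}
  | 1 => {1, 3, 5, 6}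
  | 2 => {2, 3, 4, 6}

/-- Pauli X on qubit `i`: `X i (e_v) = e_{v'}` with `v' = v` except `v' i = v i + 1`. -/
def Xop (i : Fin 7) : H7 →ₗ[ℂ] H7 where
  toFun ψ := fun v => ψ (v + Pi.single i 1)
  map_add' _ _ := rfl
  map_smul' _ _ := by funext v; simp

/-- Pauli Z on qubit `i`: `Z i (e_v) = (-1)^(v i) e_v`. -/
def Zop (i : Fin 7) : H7 →ₗ[ℂ] H7 where
  toFun ψ := fun v => (-1 : ℂ) ^ (v i).val * ψ v
  map_add' ψ φ := by funext v; simp [mul_add]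
  map_smul' c ψ := by funext v; simp; ring

/-- Stabilizer generator `gX j = ∏_{i ∈ S j} X i` (the factors commute). -/
def gX (j : Fin 3) : H7 →ₗ[ℂ] H7 :=
  (S j).noncommProd (fun i => Xop i) (fun a _ b _ _ => by
    apply LinearMap.ext; intro ψ; funext v
    exact congrArg ψ (add_right_comm v (Pi.single a 1) (Pi.single b 1)))

/-- Stabilizer generator `gZ j = ∏_{i ∈ S j} Z i` (the factors commute). -/
def gZ (j : Fin 3) : H7 →ₗ[ℂ] H7 :=
  (S j).noncommProd (fun i => Zop i) (fun a _ b _ _ => by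
    apply LinearMap.ext; intro ψ; funext v
    show (-1:ℂ) ^ (v a).val * ((-1:ℂ) ^ (v b).val * ψ v)
       = (-1:ℂ) ^ (v b).val * ((-1:ℂ) ^ (v a).val * ψ v)
    ring)

/-- Indicator vector of `S j`. -/
def r (j : Fin 3) : V7 := fun i => if i ∈ S j then 1 else 0

/-- The 𝔽₂-span of the three rows. -/
def Hcode : Submodule (ZMod 2) V7 := Submodule.span (ZMod 2) {r 0, r 1, r 2}

/-- Standard basis vector `e_v`. -/
def e (v : V7) : H7 := Pi.single v 1

/-- Logical codeword `u₀ = 8^{-1/2} ∑_{v ∈ H} e_v`. -/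
def u0 : H7 := ((Real.sqrt 8 : ℂ))⁻¹ • ∑ᶠ v ∈ (Hcode : Set V7), e v

/-- Logical codeword `u₁ = 8^{-1/2} ∑_{v ∈ H} e_{v + 𝟙}`. -/
def u1 : H7 := ((Real.sqrt 8 : ℂ))⁻¹ • ∑ᶠ v ∈ (Hcode : Set V7), e (v + 1)

/-- The codespace `C = Span_ℂ {u₀, u₁}`. -/
def Cspace : Submodule ℂ H7 := Submodule.span ℂ {u0, u1}


lemma gX_apply (j : Fin 3) (φ : H7) (v : V7) : gX j φ v = φ (v + r j) := by
  have key : ∀ (a b c d : Fin 7), Xop a (Xop b (Xop c (Xop d φ))) v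
      = φ (v + Pi.single a 1 + Pi.single b 1 + Pi.single c 1 + Pi.single d 1) :=
    fun a b c d => rfl
  have h0 : (Pi.single 0 1 + Pi.single 4 1 + Pi.single 5 1 + Pi.single 6 1 : V7) = r 0 := by
    decide
  have h1 : (Pi.single 1 1 + Pi.single 3 1 + Pi.single 5 1 + Pi.single 6 1 : V7) = r 1 := by
    decide
  have h2 : (Pi.single 2 1 + Pi.single 3 1 + Pi.single 4 1 + Pi.single 6 1 : V7) = r 2 := by
    decide
  fin_cases j
  · show gX 0 φ v = φ (v + r 0)
    rw [← h0, ← add_assoc, ← add_assoc, ← add_assoc, ← key]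
    simp only [gX, S]
    repeat rw [Finset.noncommProd_insert_of_notMem _ _ _ _ (by decide)]
    rw [Finset.noncommProd_singleton]
    rfl
  · show gX 1 φ v = φ (v + r 1)
    rw [← h1, ← add_assoc, ← add_assoc, ← add_assoc, ← key]
    simp only [gX, S]
    repeat rw [Finset.noncommProd_insert_of_notMem _ _ _ _ (by decide)]
    rw [Finset.noncommProd_singleton]
    rfl
  · show gX 2 φ v = φ (v + r 2)
    rw [← h2, ← add_assoc, ← add_assoc, ← add_assoc, ← key]
    simp only [gX, S]
    repeat rw [Finset.noncommProd_insert_of_notMem _ _ _ _ (by decide)]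
    rw [Finset.noncommProd_singleton]
    rfl

lemma r_mem (j : Fin 3) : r j ∈ Hcode := by
  apply Submodule.subset_span
  fin_cases j <;> simp

open Classical in
lemma sum_e_apply (a v : V7) :
    (∑ᶠ w ∈ (Hcode : Set V7), e (w + a)) v = if v - a ∈ Hcode then 1 else 0 := by
  rw [finsum_mem_eq_finite_toFinset_sum _ (Set.toFinite _), Finset.sum_apply]
  have : ∀ w : V7, e (w + a) v = if v - a = w then (1 : ℂ) else 0 := by
    intro w
    simp only [e, Pi.single_apply, sub_eq_iff_eq_add]
  simp only [this]
  rw [Finset.sum_ite_eq]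
  simp

lemma sum_e_shift (a v : V7) (j : Fin 3) :
    (∑ᶠ w ∈ (Hcode : Set V7), e (w + a)) (v + r j)
      = (∑ᶠ w ∈ (Hcode : Set V7), e (w + a)) v := by
  classical
  rw [sum_e_apply, sum_e_apply, add_sub_right_comm]
  simp only [Submodule.add_mem_iff_left _ (r_mem j)]

lemma code_shift (ψ : H7) (hψ : ψ ∈ Cspace) (j : Fin 3) (v : V7) : ψ (v + r j) = ψ v := by
  induction hψ using Submodule.span_induction with
  | mem x hx =>
    rcases hx with rfl | rfl
    · have := sum_e_shift 0 v j
      simp only [add_zero] at this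
      simp only [u0, Pi.smul_apply, this]
    · simp only [u1, Pi.smul_apply, sum_e_shift 1 v j]
  | zero => rfl
  | add x y _ _ hx hy => simp only [Pi.add_apply, hx, hy]
  | smul c x _ hx => simp only [Pi.smul_apply, hx]

lemma anti (ψ : H7) (hψ : ψ ∈ Cspace) (i : Fin 7) (j : Fin 3) (h : r j i = 1) :
    gX j (Zop i ψ) = -(Zop i ψ) := by
  funext v
  rw [gX_apply, Pi.neg_apply]
  show (-1 : ℂ) ^ ((v + r j) i).val * ψ (v + r j) = -((-1 : ℂ) ^ (v i).val * ψ v)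
  rw [code_shift ψ hψ, Pi.add_apply, h]
  have : ∀ x : ZMod 2, (-1 : ℂ) ^ (x + 1).val = -(-1 : ℂ) ^ x.val := by
    intro x
    fin_cases x
    · show (-1 : ℂ) ^ 1 = -(-1 : ℂ) ^ 0
      norm_num
    · show (-1 : ℂ) ^ 0 = -(-1 : ℂ) ^ 1
      norm_num
  rw [this, neg_mul]

lemma comm_fix (ψ : H7) (hψ : ψ ∈ Cspace) (i : Fin 7) (j : Fin 3) (h : r j i = 0) :
    gX j (Zop i ψ) = Zop i ψ := by
  funext v
  rw [gX_apply]
  show (-1 : ℂ) ^ ((v + r j) i).val * ψ (v + r j) = (-1 : ℂ) ^ (v i).val * ψ v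
  rw [code_shift ψ hψ, Pi.add_apply, h, add_zero]

/-- The Z-error on qubit 6 is flagged by syndrome (1,1,1) and only by it:
all three X-stabilizers anti-commute past `Z 6`, whereas for any other qubit
some X-stabilizer leaves the corrupted state fixed.  (This is the paper's
derivation of `z₆ = d ∧ e ∧ f`.) -/
theorem z6_syndrome (ψ : H7) (hψ : ψ ∈ Cspace) :
    (∀ j : Fin 3, gX j (Zop 6 ψ) = -(Zop 6 ψ)) ∧
    (∀ i : Fin 7, i ≠ 6 → ∃ j : Fin 3, gX j (Zop i ψ) = Zop i ψ) := by
  have h6 : ∀ j : Fin 3, r j 6 = 1 := by decide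
  have hi : ∀ i : Fin 7, i ≠ 6 → ∃ j : Fin 3, r j i = 0 := by decide
  refine ⟨fun j => anti ψ hψ 6 j (h6 j), fun i hne => ?_⟩
  obtain ⟨j, hj⟩ := hi i hne
  exact ⟨j, comm_fix ψ hψ i j hj⟩

end
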